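/- Let D be a nontrivial regular (v,k,λ,μ)-partial difference set in a finite abelian group G with λ − μ = −1. Then, up to complementation, the parameters are of Paley type or equal to (243, 22, 1, 2); that is, (v, k, λ, μ) = (v, (v−1)/2, (v−5)/4, (v−1)/4), or (v, k, λ, μ) = (243, 22, 1, 2), or (v, k, λ, μ) = (243, 220, 199, 200). -/

import Mathlib

open Finset

variable {G : Type*} [CommGroup G] [Fintype G] [DecidableEq G]

/-- `D` is a `(v,k,l,m)`-partial difference set in `G`: every non-identity element of `D`
has exactly `l` representations as `d₁ * d₂⁻¹` with `d₁ ≠ d₂` in `D`, and every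
non-identity element not in `D` has exactly `m` such representations. -/
def IsPDS (D : Finset G) (v k l m : ℕ) : Prop :=
  Fintype.card G = v ∧ D.card = k ∧
  (∀ g : G, g ≠ 1 → g ∈ D →
    ((D ×ˢ D).filter (fun x => x.1 ≠ x.2 ∧ x.1 * x.2⁻¹ = g)).card = l) ∧
  (∀ g : G, g ≠ 1 → g ∉ D →
    ((D ×ˢ D).filter (fun x => x.1 ≠ x.2 ∧ x.1 * x.2⁻¹ = g)).card = m)

/-- A regular PDS: additionally `D⁽⁻¹⁾ = D` and `1 ∉ D`. -/
def IsRegularPDS (D : Finset G) (v k l m : ℕ) : Prop :=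
  IsPDS D v k l m ∧ (∀ d : G, d ∈ D ↔ d⁻¹ ∈ D) ∧ (1 : G) ∉ D

/-- A regular Paley type PDS: a regular `(v, (v-1)/2, (v-5)/4, (v-1)/4)`-PDS,
encoded without division as `v = 2k+1`, `v = 4l+5`, `v = 4m+1`. -/
def IsPaleyPDS (D : Finset G) : Prop :=
  ∃ k l m : ℕ, IsRegularPDS D (Fintype.card G) k l m ∧
    Fintype.card G = 2 * k + 1 ∧ Fintype.card G = 4 * l + 5 ∧ Fintype.card G = 4 * m + 1

/-- A regular PDS is trivial if `D ∪ {1}` or `G \ D` is a subgroup of `G`. -/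
def IsTrivialPDS (D : Finset G) : Prop :=
  (∃ S : Subgroup G, (S : Set G) = ↑D ∪ {1}) ∨
  (∃ S : Subgroup G, (S : Set G) = Set.univ \ ↑D)

set_option linter.unusedSectionVars false

/-- The Pell-type sequence: `(√w + √(w-1))^(2j+1) = f √w + g √(w-1)`. -/
def pellFG (w : ℤ) : ℕ → ℤ × ℤ
  | 0 => (1, 1)
  | j + 1 => ((2 * w - 1) * (pellFG w j).1 + 2 * (w - 1) * (pellFG w j).2,
      2 * w * (pellFG w j).1 + (2 * w - 1) * (pellFG w j).2)

lemma pell_pow (w : ℤ) (a b : ℝ) (ha : a ^ 2 = w) (hb : b ^ 2 = w - 1) (j : ℕ) :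
    (a + b) ^ (2 * j + 1) = (pellFG w j).1 * a + (pellFG w j).2 * b := by
  induction j with
  | zero => simp [pellFG]
  | succ j ih =>
    have : (a + b) ^ (2 * (j + 1) + 1) = (a + b) ^ (2 * j + 1) * (a + b) ^ 2 := by ring
    rw [this, ih]
    simp only [pellFG]
    push_cast
    linear_combination ((pellFG w j).1 * a + (pellFG w j).2 * b) * (ha + hb)
      + 2 * (pellFG w j).1 * b * ha + 2 * (pellFG w j).2 * a * hb

lemma pell_descent (w : ℤ) (hw : 2 ≤ w) (n : ℕ) : ∀ u t : ℤ, 0 < u → u ≤ n → 0 ≤ t →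
    t ^ 2 = (u ^ 2 * w - 1) * (w - 1) →
    ∃ j, u = (pellFG w j).1 ∧ t = (w - 1) * (pellFG w j).2 := by
  induction n with
  | zero => intro u t h1 h2; simp at h2; omega
  | succ n ih =>
    intro u t hu hun ht h
    rcases eq_or_lt_of_le (show 1 ≤ u by omega) with h1 | h1
    · refine ⟨0, by simp [pellFG, ← h1], ?_⟩
      simp only [pellFG, mul_one]
      subst h1
      have : t ^ 2 = (w - 1) ^ 2 := by rw [h]; ring
      exact (sq_eq_sq₀ ht (by omega)).1 this
    · set u' := (2 * w - 1) * u - 2 * t with hu'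
      set t' := (2 * w - 1) * t - 2 * u * w * (w - 1) with ht'
      have h' : t' ^ 2 = (u' ^ 2 * w - 1) * (w - 1) := by
        rw [hu', ht']; linear_combination h
      have e1 : u = (2 * w - 1) * u' + 2 * t' := by rw [hu', ht']; ring
      have e2 : t = (2 * w - 1) * t' + 2 * u' * w * (w - 1) := by rw [hu', ht']; ring
      have pos : 0 < u' := by
        have : (2 * t) ^ 2 < ((2 * w - 1) * u) ^ 2 := by nlinarith
        have := lt_of_pow_lt_pow_left₀ 2 (by nlinarith) this
        omega
      have lt : u' < u := by
        have : ((w - 1) * u) ^ 2 < t ^ 2 := by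
          rw [h]
          have : 0 < (w - 1) * (u ^ 2 - 1) := by apply mul_pos <;> nlinarith
          nlinarith
        have := lt_of_pow_lt_pow_left₀ 2 ht this
        rw [hu']; linarith
      have tpos : 0 ≤ t' := by
        by_contra hneg
        push Not at hneg
        have : (2 * (-t')) ^ 2 < ((2 * w - 2) * u') ^ 2 := by
          apply pow_lt_pow_left₀ _ (by linarith) (by norm_num)
          linarith
        have h3 : (w - 1) * (u' ^ 2 * w - 1) < (w - 1) * ((w - 1) * u' ^ 2) := by nlinarith
        have := lt_of_mul_lt_mul_left h3 (by linarith)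
        nlinarith
      obtain ⟨j, hj1, hj2⟩ := ih u' t' pos (by push_cast at hun; omega) tpos h'
      refine ⟨j + 1, ?_, ?_⟩
      · simp only [pellFG]; rw [e1, hj2, hj1]; ring
      · simp only [pellFG]; rw [e2, hj2, hj1]; ring

lemma sum_range_two_mul' (F : ℕ → ℝ) (m : ℕ) :
    ∑ k ∈ range (2 * m), F k = ∑ i ∈ range m, (F (2 * i) + F (2 * i + 1)) := by
  induction m with
  | zero => simp
  | succ m ih => rw [show 2 * (m + 1) = 2 * m + 1 + 1 by ring, sum_range_succ, sum_range_succ,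
      sum_range_succ, ih]; ring

lemma pell_sum (w : ℤ) (hw : 1 ≤ w) (j : ℕ) :
    (pellFG w j).1 = ∑ i ∈ range (j + 1), ((2 * j + 1).choose (2 * i + 1) : ℤ) *
      w ^ i * (w - 1) ^ (j - i) := by
  have hwr : (1 : ℝ) ≤ w := by exact_mod_cast hw
  set a := √(w : ℝ) with ha
  set b := √((w : ℝ) - 1) with hb
  have ha2 : a ^ 2 = w := Real.sq_sqrt (by linarith)
  have hb2 : b ^ 2 = w - 1 := Real.sq_sqrt (by linarith)
  have ha0 : a ≠ 0 := by positivity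
  have h1 := pell_pow w a b ha2 hb2 j
  have h2 := pell_pow w a (-b) ha2 (by rw [neg_sq]; exact hb2) j
  rw [add_pow, show 2 * j + 1 + 1 = 2 * (j + 1) by ring, sum_range_two_mul'] at h1 h2
  have h3 := congrArg₂ (· + ·) h1 h2
  simp only [← sum_add_distrib] at h3
  have h4 : (2 * a) * ((pellFG w j).1 : ℝ) = (2 * a) * ((∑ i ∈ range (j + 1),
      ((2 * j + 1).choose (2 * i + 1) : ℤ) * w ^ i * (w - 1) ^ (j - i) : ℤ) : ℝ) := by
    rw [show (2 * a) * ((pellFG w j).1 : ℝ) = (pellFG w j).1 * a + (pellFG w j).2 * b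
      + ((pellFG w j).1 * a + (pellFG w j).2 * -b) by ring, ← h3]
    push_cast
    rw [mul_sum]
    apply sum_congr rfl
    intro i hi
    have hij : i ≤ j := by simp at hi; omega
    have e1 : 2 * j + 1 - 2 * i = 2 * (j - i) + 1 := by omega
    have e2 : 2 * j - 2 * i = 2 * (j - i) := by omega
    rw [e1, e2, pow_succ (-b), pow_mul (-b), neg_sq, pow_succ b, pow_mul b, pow_succ a, pow_mul a,
      ha2, hb2]
    ring
  have := mul_left_cancel₀ (by positivity) h4
  exact_mod_cast this

lemma pell_triple (w : ℤ) (hw : 1 ≤ w) (j : ℕ) :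
    (pellFG w (3 * j + 1)).1 = (4 * w - 3) * (pellFG (w * (4 * w - 3) ^ 2) j).1 := by
  have hwr : (1 : ℝ) ≤ w := by exact_mod_cast hw
  set a := √(w : ℝ) with ha
  set b := √((w : ℝ) - 1) with hb
  have ha2 : a ^ 2 = w := Real.sq_sqrt (by linarith)
  have hb2 : b ^ 2 = w - 1 := Real.sq_sqrt (by linarith)
  have ha0 : a ≠ 0 := by positivity
  have key : ∀ c : ℝ, c ^ 2 = w - 1 →
     ((pellFG w (3 * j + 1)).1 : ℝ) * a + (pellFG w (3 * j + 1)).2 * c =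
      (pellFG (w * (4 * w - 3) ^ 2) j).1 * ((4 * w - 3) * a) +
      (pellFG (w * (4 * w - 3) ^ 2) j).2 * ((4 * w - 1) * c) := by
    intro c hc
    rw [← pell_pow w a c ha2 hc, ← pell_pow (w * (4 * w - 3) ^ 2)]
    · rw [show 2 * (3 * j + 1) + 1 = 3 * (2 * j + 1) by ring, pow_mul]
      congr 1
      linear_combination (a + 3 * c) * ha2 + (3 * a + c) * hc
    · rw [mul_pow, ha2]; push_cast; ring
    · rw [mul_pow, hc]; push_cast; ring
  have h1 := key b hb2
  have h2 := key (-b) (by rw [neg_sq]; exact hb2)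
  have : a * ((pellFG w (3 * j + 1)).1 : ℝ)
      = a * (((4 * w - 3) * (pellFG (w * (4 * w - 3) ^ 2) j).1 : ℤ) : ℝ) := by
    push_cast
    linarith
  have := mul_left_cancel₀ ha0 this
  exact_mod_cast this

lemma pell_lower (w : ℤ) (hw : 1 ≤ w) (j : ℕ) :
    (2 * j + 1 : ℤ) * (w - 1) ^ j ≤ (pellFG w j).1 := by
  rw [pell_sum w hw, sum_range_succ']
  have : 0 ≤ ∑ k ∈ range j, ((2 * j + 1).choose (2 * (k + 1) + 1) : ℤ) *
      w ^ (k + 1) * (w - 1) ^ (j - (k + 1)) := by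
    apply sum_nonneg
    intro i _
    have : 0 ≤ w - 1 := by omega
    positivity
  simp
  linarith

lemma pell_dvd (w : ℤ) (hw : 1 ≤ w) (j : ℕ) (p : ℕ) (hp : p.Prime) (hpw : (p : ℤ) ∣ w)
    (h : (p : ℤ) ∣ (pellFG w j).1) : p ∣ 2 * j + 1 := by
  rw [pell_sum w hw, sum_range_succ', dvd_add_right] at h
  · simp only [mul_zero, zero_add, Nat.choose_one_right, pow_zero, mul_one, Nat.sub_zero] at h
    have hpp := Nat.prime_iff_prime_int.1 hp
    rcases hpp.dvd_or_dvd h with h | h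
    · exact_mod_cast h
    · have := hpp.dvd_of_dvd_pow h
      have := (Int.dvd_sub hpw this)
      simp at this
      exact absurd (Int.isUnit_iff_natAbs_eq.1 (isUnit_of_dvd_one this)) (by simpa using hp.one_lt.ne')
  · apply dvd_sum
    intro i _
    apply Dvd.dvd.mul_right
    apply Dvd.dvd.mul_left
    exact dvd_pow hpw (by omega)

lemma two_mul_lt_pow (i : ℕ) (hi : 1 ≤ i) : 2 * i + 1 < 5 ^ i := by
  induction i, hi using Nat.le_induction with
  | base => norm_num
  | succ n _ ih => rw [pow_succ]; omega

lemma pell_val (w : ℤ) (hw : 1 ≤ w) (j : ℕ) (p κ : ℕ) (hp : p.Prime) (hκ : 1 ≤ κ)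
    (hpw : ((p ^ κ : ℕ) : ℤ) ∣ w) (h5 : 5 ≤ p ^ κ) (e : ℕ)
    (h : ((p ^ e : ℕ) : ℤ) ∣ (pellFG w j).1) : p ^ e ∣ 2 * j + 1 := by
  have hpp := Nat.prime_iff_prime_int.1 hp
  by_contra hne
  obtain ⟨v, r, hr, hvr⟩ := Nat.exists_eq_pow_mul_and_not_dvd (n := 2 * j + 1) (by omega) p hp.ne_one
  have hve : v + 1 ≤ e := by
    by_contra hlt
    exact hne ((pow_dvd_pow p (by omega)).trans (hvr ▸ Dvd.intro _ rfl))
  have h1 : ((p ^ (v + 1) : ℕ) : ℤ) ∣ (pellFG w j).1 :=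
    (Int.natCast_dvd_natCast.2 (pow_dvd_pow p hve)).trans h
  rw [pell_sum w hw, sum_range_succ', dvd_add_right] at h1
  · simp only [mul_zero, zero_add, Nat.choose_one_right, pow_zero, mul_one, Nat.sub_zero] at h1
    have hcop : IsCoprime ((p ^ (v + 1) : ℕ) : ℤ) ((w - 1) ^ j) := by
      push_cast
      apply IsCoprime.pow
      obtain ⟨c, hc⟩ := (Int.natCast_dvd_natCast.2 (dvd_pow_self p (by omega : κ ≠ 0))).trans hpw
      exact ⟨c, -1, by rw [hc]; ring⟩
    have h2 := hcop.dvd_of_dvd_mul_right h1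
    have h3 : p ^ (v + 1) ∣ 2 * j + 1 := by exact_mod_cast h2
    rw [hvr, pow_succ] at h3
    exact hr (Nat.dvd_of_mul_dvd_mul_left (pow_pos hp.pos v) h3)
  · apply dvd_sum
    intro i _
    apply Dvd.dvd.mul_right
    set i' := i + 1 with hi'
    obtain ⟨c, m, hm, hcm⟩ := Nat.exists_eq_pow_mul_and_not_dvd (n := 2 * i' + 1) (by omega) p hp.ne_one
    have hc : c < κ * i' := by
      have a1 := two_mul_lt_pow i' (by omega)
      have a2 : 5 ^ i' ≤ (p ^ κ) ^ i' := Nat.pow_le_pow_left h5 _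
      have a3 : p ^ c ≤ 2 * i' + 1 := Nat.le_of_dvd (by omega) (hcm ▸ Dvd.intro _ rfl)
      rw [← pow_mul] at a2
      exact (Nat.pow_lt_pow_iff_right hp.one_lt).1 (by omega)
    obtain ⟨q, hq⟩ : ((p ^ (κ * i') : ℕ) : ℤ) ∣ w ^ i' := by
      rw [pow_mul]; push_cast; exact pow_dvd_pow_of_dvd (by exact_mod_cast hpw) _
    have hch := Nat.add_one_mul_choose_eq (2 * j) (2 * i')
    have h6 : ((p ^ c : ℕ) : ℤ) * ((p ^ (v + 1) : ℕ)) ∣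
        (p ^ c : ℕ) * (m * (((2 * j + 1).choose (2 * i' + 1) : ℤ) * w ^ i')) := by
      have : ((p ^ c : ℕ) : ℤ) * (m * (((2 * j + 1).choose (2 * i' + 1) : ℤ) * w ^ i'))
          = (p ^ v : ℕ) * (p ^ (κ * i') : ℕ) * (r * (2 * j).choose (2 * i') * q) := by
        have e1 : ((p ^ c : ℕ) : ℤ) * m = ((2 * i' + 1 : ℕ) : ℤ) := by rw [hcm]; push_cast; ring
        have e2 : ((p ^ v : ℕ) : ℤ) * r = ((2 * j + 1 : ℕ) : ℤ) := by rw [hvr]; push_cast; ring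
        have e3 : ((2 * j + 1 : ℕ) : ℤ) * ((2 * j).choose (2 * i') : ℤ) =
            ((2 * j + 1).choose (2 * i' + 1) : ℤ) * ((2 * i' + 1 : ℕ) : ℤ) := by exact_mod_cast hch
        rw [hq]
        linear_combination ((2 * j + 1).choose (2 * i' + 1) : ℤ) * (p ^ (κ * i') : ℕ) * q * e1
          - (p ^ (κ * i') : ℕ) * ((2 * j).choose (2 * i') : ℤ) * q * e2
          - (p ^ (κ * i') : ℕ) * q * e3
      rw [this]
      apply Dvd.dvd.mul_right
      rw [← Nat.cast_mul, ← Nat.cast_mul, ← pow_add, ← pow_add]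
      exact Int.natCast_dvd_natCast.2 (pow_dvd_pow p (by omega))
    have h7 := (mul_dvd_mul_iff_left (by exact_mod_cast (pow_pos hp.pos c).ne')).1 h6
    have hcop : IsCoprime ((p ^ (v + 1) : ℕ) : ℤ) (m : ℤ) :=
      Nat.isCoprime_iff_coprime.2 (Nat.Coprime.pow_left _ ((Nat.Prime.coprime_iff_not_dvd hp).2 hm))
    exact hcop.dvd_of_dvd_mul_left h7

lemma u1_dvd (w : ℤ) (hw : 1 ≤ w) (j : ℕ) (u1 : ℕ) (x : ℕ)
    (h : (u1 : ℤ) ∣ x * (pellFG w j).1)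
    (hp : ∀ p : ℕ, p.Prime → p ∣ u1 → ∃ κ, 1 ≤ κ ∧ ((p ^ κ : ℕ) : ℤ) ∣ w ∧ 5 ≤ p ^ κ) :
    u1 ∣ x * (2 * j + 1) := by
  rw [Nat.dvd_iff_prime_pow_dvd_dvd]
  intro p k hpp hk
  rcases Nat.eq_zero_or_pos k with rfl | hk0
  · simp
  obtain ⟨κ, h1, h2, h3⟩ := hp p hpp ((dvd_pow_self p hk0.ne').trans hk)
  have hd : p ^ k ∣ x * (pellFG w j).1.natAbs := by
    have := Int.natAbs_dvd_natAbs.2 ((Int.natCast_dvd_natCast.2 hk).trans h)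
    rwa [Int.natAbs_mul, Int.natAbs_natCast, Int.natAbs_natCast] at this
  obtain ⟨d1, d2, hd1, hd2, hd12⟩ := (Nat.dvd_mul).1 hd
  obtain ⟨a, -, rfl⟩ := (Nat.dvd_prime_pow hpp).1 (hd12 ▸ Dvd.intro _ rfl : d1 ∣ p ^ k)
  obtain ⟨b, -, rfl⟩ := (Nat.dvd_prime_pow hpp).1 (hd12 ▸ Dvd.intro_left _ rfl : d2 ∣ p ^ k)
  rw [← hd12]
  exact mul_dvd_mul hd1 (pell_val w hw j p κ hpp h1 h2 h3 b (Int.natCast_dvd.2 hd2))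

lemma pow16 (j : ℕ) (hj : 2 ≤ j) : (2 * (2 * j + 1) ^ 2 : ℤ) ≤ 16 ^ j := by
  induction j, hj using Nat.le_induction with
  | base => norm_num
  | succ n hn ih => rw [pow_succ (16 : ℤ) n]; push_cast; nlinarith

lemma pow242 (i : ℕ) : ((2 * i + 3) ^ 2 : ℤ) ≤ 9 * (242 ^ i) ^ 2 := by
  induction i with
  | zero => norm_num
  | succ n ih =>
    rw [pow_succ (242 : ℤ) n, mul_pow]; push_cast
    have h0 : (0 : ℤ) ≤ n := by positivity
    have h1 : (2 * ((n : ℤ) + 1) + 3) ^ 2 ≤ 58564 * (2 * n + 3) ^ 2 := by nlinarith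
    linarith

lemma boundA (w x W r U u1 : ℤ) (j1 : ℕ) (hj10 : 0 < j1) (hw : 3 ≤ w) (hx9 : 9 ≤ x)
    (hW : W = w * x ^ 2) (hW243 : 243 ≤ W) (hrr : r = 2 * j1 + 1)
    (hlow2 : r * (W - 1) ^ j1 ≤ U) (hu0 : 0 ≤ u1) (hu1le : u1 ≤ x * r)
    (ht2 : ((x * U) ^ 2 * w - 1) * (w - 1) < (u1 ^ 2 * w) ^ 2) : False := by
  have hr3 : 3 ≤ r := by omega
  have b1 : r ^ 2 * (W - 1) ^ 2 ≤ 9 * ((W - 1) ^ j1) ^ 2 := by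
    obtain ⟨i, rfl⟩ : ∃ i, j1 = i + 1 := ⟨j1 - 1, by omega⟩
    have c1 := pow242 i
    have c2 : (242 : ℤ) ^ i ≤ (W - 1) ^ i := pow_le_pow_left₀ (by norm_num) (by omega) _
    have c3 : r ^ 2 ≤ 9 * (242 ^ i) ^ 2 := by
      have : r = 2 * i + 3 := by push_cast at hrr; omega
      rw [this]; exact c1
    have c4 : ((242 : ℤ) ^ i) ^ 2 ≤ ((W - 1) ^ i) ^ 2 := pow_le_pow_left₀ (by positivity) c2 2
    rw [pow_succ (W - 1) i, mul_pow]
    have h0 : 0 ≤ (W - 1) ^ 2 := by positivity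
    have := mul_le_mul_of_nonneg_right (c3.trans (mul_le_mul_of_nonneg_left c4 (by norm_num))) h0
    linarith
  have hU0 : 0 < U := lt_of_lt_of_le (mul_pos (by omega) (pow_pos (by omega) _)) hlow2
  have b2 : r ^ 2 * (r ^ 2 * (W - 1) ^ 2) ≤ 9 * U ^ 2 := by
    have h1 : (r * (W - 1) ^ j1) ^ 2 ≤ U ^ 2 :=
      pow_le_pow_left₀ (mul_nonneg (by omega) (pow_nonneg (by omega) _)) hlow2 2
    rw [mul_pow] at h1
    have : r ^ 2 * (r ^ 2 * (W - 1) ^ 2) ≤ r ^ 2 * (9 * ((W - 1) ^ j1) ^ 2) :=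
      mul_le_mul_of_nonneg_left b1 (by positivity)
    linarith
  have b3 : W ^ 2 ≤ 4 * (W - 1) ^ 2 := by nlinarith
  have b4 : r ^ 4 * W ^ 2 ≤ 36 * U ^ 2 := by
    have : r ^ 4 * W ^ 2 ≤ r ^ 4 * (4 * (W - 1) ^ 2) :=
      mul_le_mul_of_nonneg_left b3 (by positivity)
    linarith
  have b5 : (u1 ^ 2 * w) ^ 2 ≤ ((x * r) ^ 2 * w) ^ 2 := by
    apply pow_le_pow_left₀ (by positivity)
    apply mul_le_mul_of_nonneg_right _ (by positivity)
    exact pow_le_pow_left₀ (by positivity) hu1le 2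
  have b6 : ((x * r) ^ 2 * w) ^ 2 = r ^ 4 * W ^ 2 := by rw [hW]; ring
  have b7 : ((x * U) ^ 2 * w - 1) * (w - 1) < 36 * U ^ 2 := by linarith
  have b9 : 0 < U ^ 2 := by positivity
  have b8 : 81 * U ^ 2 ≤ (x * U) ^ 2 := by
    rw [mul_pow]; exact mul_le_mul_of_nonneg_right (by nlinarith) b9.le
  have b10 : 81 * U ^ 2 * 3 ≤ (x * U) ^ 2 * w := mul_le_mul b8 hw (by norm_num) (by positivity)
  have b11 : (81 * U ^ 2 * 3 - 1) * 2 ≤ ((x * U) ^ 2 * w - 1) * (w - 1) :=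
    mul_le_mul (by linarith) (by linarith) (by norm_num) (by linarith)
  linarith

lemma boundB (w r u u1 : ℤ) (j : ℕ) (hj2 : 2 ≤ j) (hw5 : 5 ≤ w) (hrr : r = 2 * j + 1)
    (hu : 2 ≤ u) (hlow : r * (w - 1) ^ j ≤ u) (hu0 : 0 ≤ u1) (hu1le : u1 ≤ r)
    (ht2 : (u ^ 2 * w - 1) * (w - 1) < (u1 ^ 2 * w) ^ 2) : False := by
    have b0 : (4 : ℤ) ^ j ≤ (w - 1) ^ j := pow_le_pow_left₀ (by norm_num) (by omega) _
    have b1 : 2 * r ^ 2 ≤ ((w - 1 : ℤ) ^ j) ^ 2 := by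
      have c1 := pow16 j hj2
      have c2 : ((4 : ℤ) ^ j) ^ 2 = 16 ^ j := by rw [← pow_mul, mul_comm, pow_mul]; norm_num
      have := pow_le_pow_left₀ (by positivity) b0 2
      rw [hrr]
      linarith
    have b2 : r ^ 2 * (2 * r ^ 2) ≤ (u : ℤ) ^ 2 := by
      have : (r * (w - 1 : ℤ) ^ j) ^ 2 ≤ (u : ℤ) ^ 2 :=
        pow_le_pow_left₀ (mul_nonneg (by omega) (pow_nonneg (by omega) _)) hlow 2
      rw [mul_pow] at this
      linarith [mul_le_mul_of_nonneg_left b1 (sq_nonneg r)]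
    have b5 : ((u1 : ℤ) ^ 2 * w) ^ 2 ≤ (r ^ 2 * w) ^ 2 := by
      apply pow_le_pow_left₀ (by positivity)
      apply mul_le_mul_of_nonneg_right _ (by positivity)
      exact pow_le_pow_left₀ (by positivity) hu1le 2
    have b6 : 2 * (r ^ 2 * w) ^ 2 ≤ (u : ℤ) ^ 2 * w ^ 2 := by
      have := mul_le_mul_of_nonneg_right b2 (sq_nonneg (w : ℤ))
      linarith
    have hu1' : (4 : ℤ) ≤ u ^ 2 := by nlinarith
    have b7 : 2 * (((u : ℤ) ^ 2 * w - 1) * (w - 1)) < (u : ℤ) ^ 2 * w ^ 2 := by linarith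
    nlinarith [mul_le_mul_of_nonneg_right hu1' (show (0 : ℤ) ≤ w * (w - 2) by nlinarith)]

set_option maxHeartbeats 1000000 in
lemma nt_main (u w t u1 u2 : ℕ) (hw : 3 ≤ w) (hwodd : Odd w) (hu : 1 < u)
    (ht : (t : ℤ) ^ 2 = ((u : ℤ) ^ 2 * w - 1) * (w - 1))
    (hp : ∀ p : ℕ, p.Prime → p ∣ w → p ∣ u) (hu12 : u = u1 * u2)
    (hp1 : ∀ p : ℕ, p.Prime → p ∣ u1 → p ∣ w)
    (hle : (t : ℤ) ≤ u1 ^ 2 * w - 1) : w = 3 ∧ u = 9 := by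
  have hwz : (3 : ℤ) ≤ w := by exact_mod_cast hw
  obtain ⟨j, hj1, -⟩ := pell_descent w (by omega) u u t (by omega) le_rfl (by omega) ht
  have hpodd : ∀ p : ℕ, p.Prime → p ∣ w → p = 3 ∨ 5 ≤ p := by
    intro p hpp hpw
    have := hpp.two_le
    have h2 : p ≠ 2 := by
      rintro rfl
      exact (Nat.not_even_iff_odd.2 hwodd) (even_iff_two_dvd.2 hpw)
    have h4 : p ≠ 4 := by rintro rfl; revert hpp; decide
    omega
  have hr : ∀ p : ℕ, p.Prime → p ∣ w → p ∣ 2 * j + 1 := by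
    intro p hpp hpw
    apply pell_dvd w (by omega) j p hpp (Int.natCast_dvd_natCast.2 hpw)
    rw [← hj1]; exact Int.natCast_dvd_natCast.2 (hp p hpp hpw)
  have hu1u : u1 ∣ u := hu12 ▸ Dvd.intro _ rfl
  have hlow := pell_lower w (by omega) j
  rw [← hj1] at hlow
  have ht2 : ((u : ℤ) ^ 2 * w - 1) * (w - 1) < (u1 ^ 2 * w) ^ 2 := by
    rw [← ht]; apply pow_lt_pow_left₀ (by omega) (by omega) (by norm_num)
  by_cases h3 : 3 ∣ w
  · have h3r := hr 3 (by norm_num) h3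
    obtain ⟨j1, rfl⟩ : ∃ j1, j = 3 * j1 + 1 := ⟨(j - 1) / 3, by omega⟩
    rw [pell_triple w (by omega)] at hj1
    rcases Nat.eq_zero_or_pos j1 with rfl | hj10
    · simp only [pellFG, mul_one] at hj1
      by_cases hw3 : w = 3
      · subst hw3; refine ⟨rfl, by push_cast at hj1; omega⟩
      exfalso
      have h9 : 9 ∣ w := by
        obtain ⟨w', rfl⟩ := h3
        obtain ⟨p, hpp, hpw'⟩ := Nat.exists_prime_and_dvd (n := w') (by omega)
        have := hr p hpp (hpw'.mul_left 3)
        have := (Nat.prime_dvd_prime_iff_eq hpp (by norm_num : Nat.Prime 3)).1 (by simpa using this)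
        subst this
        exact mul_dvd_mul_left 3 hpw'
      have hd : u1 ∣ 1 * (2 * (3 * 0 + 1) + 1) := by
        apply u1_dvd w (by omega) 1
        · simp only [pellFG]
          have : (u1 : ℤ) ∣ u := Int.natCast_dvd_natCast.2 hu1u
          rw [hj1] at this
          convert this using 1; push_cast; ring
        · intro p hpp hpu
          have hpw := hp1 p hpp hpu
          have := hr p hpp hpw
          have := (Nat.prime_dvd_prime_iff_eq hpp (by norm_num : Nat.Prime 3)).1 (by simpa using this)
          subst this
          exact ⟨2, by norm_num, by exact_mod_cast h9, by norm_num⟩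
      have hu3 : (u1 : ℤ) ≤ 3 := by exact_mod_cast Nat.le_of_dvd (by norm_num) hd
      have h9' : (9 : ℤ) ≤ w := by exact_mod_cast Nat.le_of_dvd (by omega) h9
      have hsq : (u1 : ℤ) ^ 2 ≤ 9 := by
        have := pow_le_pow_left₀ (by positivity) hu3 2
        linarith
      have : (u1 : ℤ) ^ 2 * w ≤ 9 * w := mul_le_mul_of_nonneg_right hsq (by omega)
      have h5 : ((u1 : ℤ) ^ 2 * w) ^ 2 ≤ (9 * w) ^ 2 := pow_le_pow_left₀ (by positivity) this 2
      have hu33 : (33 : ℤ) ≤ u := by omega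
      have h6 : (1089 : ℤ) ≤ u ^ 2 := by
        have := pow_le_pow_left₀ (by norm_num) hu33 2
        linarith
      have h7 : (1089 : ℤ) * w ≤ u ^ 2 * w := mul_le_mul_of_nonneg_right h6 (by omega)
      have h8 : ((1089 : ℤ) * w - 1) * (w - 1) ≤ (u ^ 2 * w - 1) * (w - 1) :=
        mul_le_mul_of_nonneg_right (by linarith) (by omega)
      nlinarith
    · exfalso
      set x : ℤ := 4 * w - 3 with hx
      have hx9 : 9 ≤ x := by omega
      set W : ℤ := w * x ^ 2 with hW
      have hW243 : 243 ≤ W := by nlinarith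
      have hlow2 := pell_lower W (by omega) j1
      set U := (pellFG W j1).1 with hU
      have hd : u1 ∣ (4 * w - 3) * (2 * j1 + 1) := by
        apply u1_dvd W (by omega) j1
        · have : (u1 : ℤ) ∣ u := Int.natCast_dvd_natCast.2 hu1u
          rw [hj1] at this
          convert this using 2; push_cast [Nat.cast_sub (show 3 ≤ 4 * w by omega)]; rfl
        · intro p hpp hpu
          have hpw := hp1 p hpp hpu
          rcases hpodd p hpp hpw with rfl | h5
          · refine ⟨2, by norm_num, ?_, by norm_num⟩
            apply Dvd.dvd.mul_left
            push_cast
            have h3x : (3 : ℤ) ∣ x := by omega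
            obtain ⟨y, hy⟩ := h3x
            exact ⟨y ^ 2, by rw [hy]; ring⟩
          · refine ⟨1, le_rfl, ?_, by simpa using h5⟩
            apply Dvd.dvd.mul_right
            simpa using Int.natCast_dvd_natCast.2 hpw
      have hu1le : (u1 : ℤ) ≤ x * (2 * j1 + 1) := by
        have := Nat.le_of_dvd (Nat.mul_pos (by omega) (by omega)) hd
        have : (u1 : ℤ) ≤ (((4 * w - 3) * (2 * j1 + 1) : ℕ) : ℤ) := by exact_mod_cast this
        push_cast [Nat.cast_sub (show 3 ≤ 4 * w by omega)] at this
        exact this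
      rw [hj1] at ht2
      exact boundA w x W _ U u1 j1 hj10 hwz hx9 hW hW243 rfl hlow2 (by positivity) hu1le ht2
  · exfalso
    obtain ⟨p, hpp, hpw⟩ := Nat.exists_prime_and_dvd (n := w) (by omega)
    have hp5 : 5 ≤ p := by
      rcases hpodd p hpp hpw with rfl | h
      · exact absurd hpw h3
      · exact h
    have hj2 : 2 ≤ j := by
      have := Nat.le_of_dvd (by omega) (hr p hpp hpw)
      omega
    have hw5 : (5 : ℤ) ≤ w := by
      have := Nat.le_of_dvd (by omega) hpw
      omega
    have hd : u1 ∣ 1 * (2 * j + 1) := by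
      apply u1_dvd w (by omega) j
      · rw [← hj1]; simpa using Int.natCast_dvd_natCast.2 hu1u
      · intro p hpp hpu
        have hpw := hp1 p hpp hpu
        rcases hpodd p hpp hpw with rfl | h5
        · exact absurd hpw h3
        · exact ⟨1, le_rfl, by simpa using Int.natCast_dvd_natCast.2 hpw, by simpa using h5⟩
    have hu1le : (u1 : ℤ) ≤ 2 * j + 1 := by
      have := Nat.le_of_dvd (by omega) hd
      omega
    exact boundB w _ u u1 j hj2 hw5 rfl (by omega) hlow (by positivity) hu1le ht2

/-- The character sum of an integer valued function. -/
noncomputable def charSum {A : Type*} [AddCommGroup A] [Fintype A] (f : A → ℤ) (χ : AddChar A ℂ) : ℂ :=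
  ∑ a, (f a : ℂ) * χ a

section
variable {A : Type*} [AddCommGroup A] [Fintype A] [DecidableEq A]

lemma charSum_zero (f : A → ℤ) : charSum f (0 : AddChar A ℂ) = ((∑ a, f a : ℤ) : ℂ) := by
  simp [charSum]

/-- inversion formula -/
lemma charSum_inv (f : A → ℤ) (a : A) :
    ∑ χ : AddChar A ℂ, charSum f χ * χ (-a) = (Fintype.card A : ℂ) * f a := by
  simp only [charSum, sum_mul, mul_assoc, ← AddChar.map_add_eq_mul]
  rw [sum_comm]
  simp only [← mul_sum, AddChar.sum_apply_eq_ite, ← sub_eq_add_neg, sub_eq_zero]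
  simp [mul_comm]

lemma charSum_sq_sum (f : A → ℤ) (hsymm : ∀ a, f (-a) = f a) :
    ∑ χ : AddChar A ℂ, charSum f χ ^ 2 = (Fintype.card A : ℂ) * ((∑ a, f a ^ 2 : ℤ) : ℂ) := by
  have h : ∀ χ : AddChar A ℂ, charSum f χ ^ 2 = ∑ a, (f a : ℂ) * (charSum f χ * χ (-a)) := by
    intro χ
    have : charSum f χ = ∑ a, (f a : ℂ) * χ (-a) := by
      unfold charSum
      rw [← Equiv.sum_comp (Equiv.neg A)]
      simp [hsymm]
    rw [sq]
    nth_rewrite 2 [this]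
    rw [mul_sum]
    exact sum_congr rfl fun a _ => by ring
  simp only [h]
  rw [sum_comm]
  simp only [← mul_sum, charSum_inv]
  push_cast
  rw [mul_sum]
  exact sum_congr rfl fun a _ => by ring

lemma charSum_sq (f : A → ℤ) (c Δ : ℤ)
    (hconv : ∀ a, ∑ b, f b * f (a - b) = c + if a = 0 then Δ else 0)
    (χ : AddChar A ℂ) (hχ : χ ≠ 0) : charSum f χ ^ 2 = Δ := by
  have h1 : charSum f χ ^ 2 = ∑ a, ((∑ b, f b * f (a - b) : ℤ) : ℂ) * χ a := by
    rw [sq]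
    unfold charSum
    rw [sum_mul_sum]
    push_cast
    simp only [sum_mul]
    rw [sum_comm (s := univ) (t := univ) (f := fun a b => (f b : ℂ) * f (a - b) * χ a)]
    refine sum_congr rfl fun b _ => ?_
    rw [← Equiv.sum_comp (Equiv.addRight b) (fun a => (f b : ℂ) * f (a - b) * χ a)]
    refine sum_congr rfl fun a _ => ?_
    simp only [Equiv.coe_addRight, add_sub_cancel_right, AddChar.map_add_eq_mul]
    ring
  rw [h1]
  simp only [hconv]
  push_cast
  simp only [add_mul, sum_add_distrib, ← mul_sum, AddChar.sum_eq_zero_iff_ne_zero.2 hχ]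
  simp

lemma sum_sq_of_conv (f : A → ℤ) (c Δ : ℤ)
    (hconv : ∀ a, ∑ b, f b * f (a - b) = c + if a = 0 then Δ else 0) :
    (∑ a, f a) ^ 2 = Fintype.card A * c + Δ := by
  have : (∑ a, f a) ^ 2 = ∑ a, ∑ b, f b * f (a - b) := by
    rw [sq, sum_mul_sum, sum_comm (s := univ) (t := univ) (f := fun a b => f b * f (a - b))]
    refine sum_congr rfl fun b _ => ?_
    rw [← Equiv.sum_comp (Equiv.addRight b) (fun x => f b * f (x - b))]
    simp
  rw [this]
  simp only [hconv]
  simp [sum_add_distrib]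

lemma int_of_integral (n u : ℤ) (hu : u ≠ 0) (θ : ℂ) (hθ : IsIntegral ℤ θ) (h : (u : ℂ) * θ = n) :
    ∃ z : ℤ, θ = z := by
  have hu' : (u : ℂ) ≠ 0 := by exact_mod_cast hu
  have h1 : θ = algebraMap ℚ ℂ ((n : ℚ) / u) := by
    simp; field_simp; rw [mul_comm] at h; exact h
  rw [h1] at hθ
  rw [isIntegral_algebraMap_iff (algebraMap ℚ ℂ).injective] at hθ
  obtain ⟨z, hz⟩ := IsIntegrallyClosed.isIntegral_iff.1 hθ
  refine ⟨z, ?_⟩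
  rw [h1, ← hz]
  simp

lemma char_integral (χ : AddChar A ℂ) (a : A) : IsIntegral ℤ (χ a) := by
  apply IsIntegral.of_pow (n := Fintype.card A) Fintype.card_pos
  rw [← AddChar.map_nsmul_eq_pow, card_nsmul_eq_zero]
  simp [isIntegral_one]

lemma charSum_integral (f : A → ℤ) (χ : AddChar A ℂ) : IsIntegral ℤ (charSum f χ) := by
  apply IsIntegral.sum
  intro a _
  apply IsIntegral.mul _ (char_integral χ a)
  exact isIntegral_algebraMap (R := ℤ) (A := ℂ) (x := f a)

/-- steps (a): the eigenvalues are integers. -/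
lemma step_a (f : A → ℤ) (h0 : f 0 = 0) (Δ : ℤ) (hΔ : 0 < Δ)
    (hs : ∑ a, f a ≠ 0) (hsq : ∀ χ : AddChar A ℂ, χ ≠ 0 → charSum f χ ^ 2 = Δ) :
    ∃ u : ℤ, 0 < u ∧ Δ = u ^ 2 ∧ u ∣ ∑ a, f a ∧
      ∃ ε : AddChar A ℂ → ℤ, (∀ χ, ε χ = 1 ∨ ε χ = -1) ∧ ∀ χ, χ ≠ 0 → charSum f χ = u * ε χ := by
  classical
  obtain ⟨z, hz⟩ : ∃ z : ℂ, z ^ 2 = Δ := ⟨(Real.sqrt Δ : ℝ), by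
    have : (0 : ℝ) ≤ Δ := by exact_mod_cast hΔ.le
    rw [← Complex.ofReal_pow, Real.sq_sqrt this]; simp⟩
  have h1 : ∀ χ : AddChar A ℂ, ∃ ε : ℤ, (ε = 1 ∨ ε = -1) ∧ (χ ≠ 0 → charSum f χ = z * ε) := by
    intro χ
    by_cases hχ : χ = 0
    · exact ⟨1, Or.inl rfl, fun h => absurd hχ h⟩
    have := hsq χ hχ
    rw [← hz, sq_eq_sq_iff_eq_or_eq_neg] at this
    rcases this with h | h
    · exact ⟨1, Or.inl rfl, fun _ => by simp [h]⟩
    · exact ⟨-1, Or.inr rfl, fun _ => by simp [h]⟩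
  choose ε hε hε2 using h1
  have h2 := charSum_inv f 0
  rw [h0, ← add_sum_erase _ _ (mem_univ (0 : AddChar A ℂ)), charSum_zero] at h2
  set s := ∑ a, f a with hsdef
  set e : ℤ := ∑ χ ∈ univ.erase (0 : AddChar A ℂ), ε χ with he
  have h3 : (s : ℂ) = - (z * e) := by
    have : ∑ χ ∈ univ.erase (0 : AddChar A ℂ), charSum f χ * χ (-0) = z * e := by
      rw [he]; push_cast; rw [mul_sum]
      refine sum_congr rfl fun χ hχ => ?_
      rw [hε2 χ (ne_of_mem_erase hχ)]; simp
    rw [this] at h2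
    simp at h2
    linear_combination h2
  have h4 : s ^ 2 = Δ * e ^ 2 := by
    have : (s : ℂ) ^ 2 = Δ * e ^ 2 := by rw [h3, ← hz]; ring
    exact_mod_cast this
  have he0 : e ≠ 0 := by rintro h; rw [h] at h4; simp at h4; exact hs h4
  obtain ⟨q, hq⟩ : e ∣ s := (Int.pow_dvd_pow_iff two_ne_zero).1 ⟨Δ, by rw [h4]; ring⟩
  have hΔq : Δ = q ^ 2 := by
    have : e ^ 2 * Δ = e ^ 2 * q ^ 2 := by rw [mul_comm, ← h4, hq]; ring
    exact mul_left_cancel₀ (pow_ne_zero 2 he0) this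
  have hq0 : q ≠ 0 := by rintro rfl; simp at hΔq; omega
  have hzq : z = q ∨ z = -q := by
    rw [← sq_eq_sq_iff_eq_or_eq_neg, hz, hΔq]; push_cast; rfl
  obtain ⟨τ, hτ, hzu⟩ : ∃ τ : ℤ, (τ = 1 ∨ τ = -1) ∧ z = |q| * τ := by
    rcases abs_choice q with h | h <;> rcases hzq with h' | h'
    · exact ⟨1, Or.inl rfl, by rw [h, h']; simp⟩
    · exact ⟨-1, Or.inr rfl, by rw [h, h']; simp⟩
    · exact ⟨-1, Or.inr rfl, by rw [h, h']; simp⟩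
    · exact ⟨1, Or.inl rfl, by rw [h, h']; simp⟩
  refine ⟨|q|, abs_pos.2 hq0, by rw [sq_abs, hΔq], ?_, fun χ => τ * ε χ, ?_, ?_⟩
  · rw [abs_dvd]; exact ⟨e, by rw [hq]; ring⟩
  · intro χ
    rcases hτ with h | h <;> rcases hε χ with h' | h' <;> simp [h, h']
  · intro χ hχ
    rw [hε2 χ hχ, hzu]; push_cast; ring

/-- step (b) -/
lemma step_b (f : A → ℤ) (a : A) (ha : f a = 1 ∨ f a = -1) (u : ℤ) (hu : 0 < u)
    (hus : u ∣ ∑ a, f a) (ε : AddChar A ℂ → ℤ)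
    (hε : ∀ χ, χ ≠ 0 → charSum f χ = u * ε χ) : u ∣ (Fintype.card A : ℤ) := by
  classical
  have h2 := charSum_inv f a
  rw [← add_sum_erase _ _ (mem_univ (0 : AddChar A ℂ)), charSum_zero] at h2
  set s := ∑ a, f a with hsdef
  set θ : ℂ := ∑ χ ∈ univ.erase (0 : AddChar A ℂ), ((ε χ : ℤ) : ℂ) * χ (-a) with hθ
  have h3 : ∑ χ ∈ univ.erase (0 : AddChar A ℂ), charSum f χ * χ (-a) = u * θ := by
    rw [hθ, mul_sum]
    refine sum_congr rfl fun χ hχ => ?_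
    rw [hε χ (ne_of_mem_erase hχ)]; ring
  rw [h3] at h2
  have h4 : (u : ℂ) * θ = ((Fintype.card A * f a - s : ℤ) : ℂ) := by
    push_cast
    rw [← h2]; simp
  have hI : IsIntegral ℤ θ := by
    apply IsIntegral.sum
    intro χ _
    exact (isIntegral_algebraMap (R := ℤ) (A := ℂ) (x := ε χ)).mul (char_integral χ _)
  obtain ⟨z, hz⟩ := int_of_integral _ u hu.ne' θ hI h4
  rw [hz] at h4
  have h5 : u * z = Fintype.card A * f a - s := by exact_mod_cast h4
  have h6 : u ∣ Fintype.card A * f a := by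
    have : (Fintype.card A : ℤ) * f a = u * z + s := by linarith
    rw [this]
    exact dvd_add (Dvd.intro _ rfl) hus
  rcases ha with h | h <;> rw [h] at h6
  · simpa using h6
  · simpa using h6

end

section
variable {A : Type*} [AddCommGroup A] [Fintype A] [DecidableEq A]

/-- group ring element attached to a function -/
noncomputable def grp (p : ℕ) (x : A → ZMod p) : AddMonoidAlgebra (ZMod p) A :=
  ∑ a, AddMonoidAlgebra.single a (x a)

lemma grp_mul (p : ℕ) (x y : A → ZMod p) :
    grp p x * grp p y = grp p (fun a => ∑ b, x b * y (a - b)) := by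
  unfold grp
  rw [sum_mul_sum]
  simp only [AddMonoidAlgebra.single_mul_single]
  have : ∀ a : A, AddMonoidAlgebra.single a (∑ b, x b * y (a - b)) =
      ∑ b, AddMonoidAlgebra.single a (x b * y (a - b)) := by
    intro a
    exact map_sum (AddMonoidAlgebra.singleAddHom a) _ _
  simp only [this]
  rw [sum_comm (s := univ) (t := univ) (f := fun a b => AddMonoidAlgebra.single a (x b * y (a - b)))]
  refine sum_congr rfl fun b _ => ?_
  rw [← Equiv.sum_comp (Equiv.addRight b)
    (fun a => AddMonoidAlgebra.single a (x b * y (a - b)))]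
  refine sum_congr rfl fun a _ => ?_
  simp [add_comm]

lemma grp_apply (p : ℕ) (x : A → ZMod p) (a : A) : (grp p x).coeff a = x a := by
  unfold grp
  simp [AddMonoidAlgebra.coeff_sum, Finsupp.single_apply]

lemma grp_add (p : ℕ) (x y : A → ZMod p) : grp p x + grp p y = grp p (x + y) := by
  unfold grp
  simp [sum_add_distrib]

lemma grp_pow (p : ℕ) [Fact p.Prime] (x : A → ZMod p) (g : A) (hg : ∀ a, p • a ≠ g) :
    (grp p x ^ p).coeff g = 0 := by
  have : CharP (AddMonoidAlgebra (ZMod p) A) p :=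
    charP_of_injective_algebraMap (FaithfulSMul.algebraMap_injective (ZMod p) _) p
  unfold grp
  rw [sum_pow_char]
  simp only [AddMonoidAlgebra.single_pow]
  simp [AddMonoidAlgebra.coeff_sum, Finsupp.single_apply, hg]

/-- If `x * x = u x + c` (convolution), then modulo `p ∤ u`, `x` is constant off `pA`. -/
lemma const_off (p : ℕ) [Fact p.Prime] (x : A → ℤ) (u c : ℤ) (hpu : ¬ (p : ℤ) ∣ u)
    (hx : ∀ a, ∑ b, x b * x (a - b) = u * x a + c) :
    ∃ d : ZMod p, ∀ g : A, (∀ a, p • a ≠ g) → (x g : ZMod p) = d := by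
  set y : A → ZMod p := fun a => (x a : ZMod p) with hy
  have hyy : ∀ a, ∑ b, y b * y (a - b) = u * y a + c := by
    intro a
    have := congrArg (fun z : ℤ => (z : ZMod p)) (hx a)
    simpa using this
  have key : ∀ n : ℕ, ∃ d : ZMod p, grp p y ^ (n + 1) = grp p (fun a => (u : ZMod p) ^ n * y a + d) := by
    intro n
    induction n with
    | zero => exact ⟨0, by simp⟩
    | succ n ih =>
      obtain ⟨d, hd⟩ := ih
      refine ⟨u ^ n * c + d * ∑ b, y b, ?_⟩
      rw [pow_succ, hd, grp_mul]
      congr 1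
      ext a
      have h2 : ∑ b, y (a - b) = ∑ b, y b := Equiv.sum_comp (Equiv.subLeft a) y
      simp only [add_mul, sum_add_distrib, mul_assoc, ← mul_sum, hyy, h2]
      ring
  have hp := (Fact.out : p.Prime)
  obtain ⟨d, hd⟩ := key (p - 1)
  refine ⟨-d, fun g hg => ?_⟩
  have h1 := grp_pow p y g hg
  rw [show p - 1 + 1 = p by have := hp.pos; omega] at hd
  rw [hd, grp_apply, ZMod.pow_card_sub_one_eq_one, one_mul] at h1
  · exact eq_neg_of_add_eq_zero_left h1
  · rwa [Ne, ZMod.intCast_zmod_eq_zero_iff_dvd]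

lemma step_c (f : A → ℤ) (h0 : f 0 = 0) (h1 : ∀ a, a ≠ 0 → f a = 1 ∨ f a = -1)
    (u : ℤ) (hu : 1 < u) (huodd : Odd u)
    (hconv : ∀ a, ∑ b, f b * f (a - b) = (Fintype.card A - 1 - u ^ 2) + if a = 0 then u ^ 2 else 0)
    (p : ℕ) (hp : p.Prime) (hpv : p ∣ Fintype.card A) : (p : ℤ) ∣ u := by
  classical
  have : Fact p.Prime := ⟨hp⟩
  by_contra hpu
  obtain ⟨q, hq⟩ := huodd
  set x : A → ℤ := fun a => if a = 0 then q + 1 else if f a = 1 then 1 else 0 with hx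
  have hx2 : ∀ a, 2 * x a = f a + 1 + if a = 0 then u else 0 := by
    intro a
    by_cases ha : a = 0
    · simp [hx, ha, h0, hq]; ring
    · rcases h1 a ha with h | h <;> simp [hx, ha, h]
  set s := ∑ a, f a with hs
  have hxx : ∀ a, 4 * ∑ b, x b * x (a - b) = 4 * (u * x a) + (2 * Fintype.card A - 1 - u ^ 2 + 2 * s) := by
    intro a
    have e1 : 4 * ∑ b, x b * x (a - b) = ∑ b, (2 * x b) * (2 * x (a - b)) := by
      rw [mul_sum]; exact sum_congr rfl fun b _ => by ring
    have e2 : ∑ b, f (a - b) = s := Equiv.sum_comp (Equiv.subLeft a) f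
    have e3 : ∀ b, (a - b = 0) = (b = a) := fun b => by rw [sub_eq_zero]; exact propext eq_comm
    have e4 : 4 * (u * x a) = 2 * u * (2 * x a) := by ring
    rw [e1, e4]
    simp only [hx2, add_mul, mul_add, sum_add_distrib, hconv, e3]
    simp [e2, ← sum_mul, ← mul_sum, ← hs]
    split_ifs <;> ring
  have hx3 : ∀ a, ∑ b, x b * x (a - b) = u * x a + (∑ b, x b * x (0 - b) - u * x 0) := by
    intro a
    have := hxx a
    have := hxx 0
    linarith
  obtain ⟨d, hd⟩ := const_off p x u _ hpu hx3
  -- the subgroup pA is proper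
  set φ : A →+ A := nsmulAddMonoidHom p with hφ
  have hns : ¬ Function.Surjective φ := by
    intro hsurj
    have hinj := Finite.injective_iff_surjective.2 hsurj
    obtain ⟨a, ha⟩ := exists_prime_addOrderOf_dvd_card p hpv
    have : a = 0 := hinj (by
      simp only [hφ, nsmulAddMonoidHom_apply, map_zero, smul_zero]
      rw [← ha]; exact addOrderOf_nsmul_eq_zero a)
    rw [this, addOrderOf_zero] at ha
    exact hp.one_lt.ne ha
  set R := φ.range with hR
  have hRne : ∃ g, g ∉ R := by
    by_contra hcon
    push Not at hcon
    exact hns fun g => hcon g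
  obtain ⟨g, hg⟩ := hRne
  have hmem : ∀ b, b ∉ R → ∀ a, p • a ≠ b := fun b hb a hab => hb ⟨a, hab⟩
  have hne0 : ∀ b, b ∉ R → b ≠ 0 := fun b hb h => hb (h ▸ R.zero_mem)
  -- f constant off R
  have hconst : ∀ b, b ∉ R → f b = f g := by
    intro b hb
    have e := (hd b (hmem b hb)).trans (hd g (hmem g hg)).symm
    have h01 : (0 : ZMod p) ≠ 1 := zero_ne_one
    rcases h1 b (hne0 b hb) with h | h <;> rcases h1 g (hne0 g hg) with h' | h' <;>
      simp [hx, hne0 b hb, hne0 g hg, h, h'] at e ⊢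
  obtain ⟨ψ, hψ⟩ := AddChar.exists_apply_ne_zero.2 
    (show (QuotientAddGroup.mk g : A ⧸ R) ≠ 0 by rwa [Ne, QuotientAddGroup.eq_zero_iff])
  set χ : AddChar A ℂ := ψ.compAddMonoidHom (QuotientAddGroup.mk' R) with hχ
  have hχ0 : χ ≠ 0 := by
    intro h
    have : χ g = 1 := by rw [h]; simp
    exact hψ (by simpa [hχ] using this)
  have hχR : ∀ a ∈ R, χ a = 1 := by
    intro a ha
    simp [hχ, (QuotientAddGroup.eq_zero_iff a).2 ha]
  have hsum : charSum f χ = ((s - f g * Fintype.card A : ℤ) : ℂ) := by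
    have e1 : charSum f χ = ∑ a, ((f a : ℂ) - f g) * χ a := by
      simp only [sub_mul, sum_sub_distrib, ← mul_sum, AddChar.sum_eq_zero_iff_ne_zero.2 hχ0]
      simp [charSum]
    have e2 : ∀ a, ((f a : ℂ) - f g) * χ a = (f a : ℂ) - f g := by
      intro a
      by_cases ha : a ∈ R
      · rw [hχR a ha, mul_one]
      · rw [hconst a ha]; simp
    rw [e1]
    simp only [e2, sum_sub_distrib]
    simp [hs, mul_comm]
  have h2 := charSum_sq f _ _ hconv χ hχ0
  rw [hsum] at h2
  have h3 : (s - f g * Fintype.card A) ^ 2 = u ^ 2 := by exact_mod_cast h2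
  have h4 := sum_sq_of_conv f _ _ hconv
  rw [← hs] at h4
  set v : ℤ := (Fintype.card A : ℤ) with hv
  have hv0 : 0 < v := by rw [hv]; exact_mod_cast Fintype.card_pos
  have hδ : f g ^ 2 = 1 := by rcases h1 g (hne0 g hg) with h | h <;> rw [h] <;> norm_num
  have h5 : v * (2 * (v - f g * s)) = v * (u ^ 2 + 1) := by
    have : (s - f g * v) ^ 2 = s ^ 2 - 2 * (f g * s) * v + f g ^ 2 * v ^ 2 := by ring
    rw [this, hδ] at h3
    linarith
  have h6 := mul_left_cancel₀ hv0.ne' h5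
  have h7 : (v - f g * s) ^ 2 = u ^ 2 := by
    rw [← h3]
    have : (s - f g * v) ^ 2 - (v - f g * s) ^ 2 = (1 - f g ^ 2) * (s ^ 2 - v ^ 2) := by ring
    rw [hδ] at this
    linarith
  rcases sq_eq_sq_iff_eq_or_eq_neg.1 h7 with h | h <;> rw [h] at h6 <;> nlinarith
end

section

lemma coprime_card_of_smul {B : Type*} [AddGroup B] [Finite B] (n h : ℕ)
    (hnh : Nat.Coprime n h) (hB : ∀ b : B, n • b = 0) : Nat.Coprime (Nat.card B) h := by
  apply Nat.Coprime.symm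
  apply Nat.coprime_of_dvd
  intro p hp hph hpB
  have : Fact p.Prime := ⟨hp⟩
  obtain ⟨b, hb⟩ := exists_prime_addOrderOf_dvd_card' p hpB
  have : p ∣ n := by rw [← hb]; exact addOrderOf_dvd_of_nsmul_eq_zero (hB b)
  exact Nat.not_coprime_of_dvd_of_dvd hp.one_lt this hph hnh

lemma exists_hall {A : Type*} [AddCommGroup A] [Fintype A] (n h : ℕ) (hnh : Nat.Coprime n h)
    (hv : Fintype.card A = n * h) : ∃ H : AddSubgroup A, Nat.card H = h := by
  set φ : A →+ A := nsmulAddMonoidHom n with hφ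
  have h1 : Nat.card φ.range * Nat.card φ.ker = n * h := by
    rw [← hv, ← Nat.card_eq_fintype_card, ← AddSubgroup.card_mul_index φ.ker, AddSubgroup.index_ker, mul_comm]
  have hn0 : 0 < n * h := hv ▸ Fintype.card_pos
  have hr : Nat.Coprime (Nat.card φ.range) n := by
    apply coprime_card_of_smul h n hnh.symm
    rintro ⟨b, a, rfl⟩
    apply Subtype.ext
    simp only [hφ, nsmulAddMonoidHom_apply, AddSubgroup.coe_nsmul, AddSubgroup.coe_zero]
    rw [← mul_nsmul, ← hv, card_nsmul_eq_zero]
  have hk : Nat.Coprime (Nat.card φ.ker) h := by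
    apply coprime_card_of_smul n h hnh
    rintro ⟨b, hb⟩
    apply Subtype.ext
    simpa [hφ] using hb
  refine ⟨φ.range, ?_⟩
  apply Nat.dvd_antisymm
  · exact hr.dvd_of_dvd_mul_left (h1 ▸ Dvd.intro _ rfl)
  · exact hk.symm.dvd_of_dvd_mul_right (h1 ▸ Dvd.intro_left _ rfl)

variable {A : Type*} [AddCommGroup A] [Fintype A] [DecidableEq A]

open Classical in
/-- restriction of `f` to a subgroup -/
noncomputable def restr (f : A → ℤ) (H : AddSubgroup A) : A → ℤ := fun a => if a ∈ H then f a else 0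

lemma charSum_restr (f : A → ℤ) (H : AddSubgroup A) (n : ℕ) (hn : Nat.card (A ⧸ H) = n)
    (χ : AddChar A ℂ) :
    (n : ℂ) * charSum (restr f H) χ =
      ∑ η : AddChar (A ⧸ H) ℂ, charSum f (χ * η.compAddMonoidHom (QuotientAddGroup.mk' H)) := by
  classical
  unfold charSum
  rw [sum_comm, mul_sum]
  refine sum_congr rfl fun a _ => ?_
  simp only [AddChar.mul_apply, AddChar.compAddMonoidHom_apply, ← mul_assoc, ← mul_sum]
  simp only [QuotientAddGroup.coe_mk', AddChar.sum_apply_eq_ite, QuotientAddGroup.eq_zero_iff, ← Nat.card_eq_fintype_card, hn, restr]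
  split_ifs
  · ring
  · simp

lemma sign_sum_odd {ι : Type*} (s : Finset ι) (ε : ι → ℤ) (hε : ∀ i, ε i = 1 ∨ ε i = -1)
    (hs : Odd s.card) : Odd (∑ i ∈ s, ε i) := by
  have h2 : (2 : ℤ) ∣ ∑ i ∈ s, (ε i - 1) := by
    apply dvd_sum
    intro i _
    rcases hε i with h | h <;> rw [h] <;> decide
  rw [sum_sub_distrib] at h2
  simp only [sum_const, nsmul_eq_mul, mul_one] at h2
  obtain ⟨k, hk⟩ := hs
  rw [hk] at h2
  rw [← Int.not_even_iff_odd, even_iff_two_dvd]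
  omega

lemma sign_sum_le {ι : Type*} (s : Finset ι) (ε : ι → ℤ) (hε : ∀ i, ε i = 1 ∨ ε i = -1) :
    |∑ i ∈ s, ε i| ≤ s.card := by
  refine (abs_sum_le_sum_abs _ _).trans ?_
  have : ∀ i ∈ s, |ε i| = 1 := by
    intro i _
    rcases hε i with h | h <;> rw [h] <;> simp
  rw [sum_congr rfl this]; simp

lemma step_d (f : A → ℤ) (h0 : f 0 = 0) (h1 : ∀ a, a ≠ 0 → f a = 1 ∨ f a = -1)
    (hsymm : ∀ a, f (-a) = f a) (u : ℤ) (hu : 0 < u) (ε : AddChar A ℂ → ℤ)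
    (hε1 : ∀ χ, ε χ = 1 ∨ ε χ = -1)
    (hε : ∀ χ, χ ≠ 0 → charSum f χ = u * ε χ) (n u2 : ℕ) (hnodd : Odd n)
    (hcop : Nat.Coprime n (u2 ^ 2)) (hv : Fintype.card A = n * u2 ^ 2)
    (hu2 : (u2 : ℤ) ∣ u) : |∑ a, f a| ≤ u * (n - 1) := by
  classical
  have hn0 : 0 < n := hnodd.pos
  have hu20 : 0 < u2 := by
    rcases Nat.eq_zero_or_pos u2 with h | h
    · rw [h] at hv; have : 0 < Fintype.card A := Fintype.card_pos
      simp at hv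
    · exact h
  obtain ⟨H, hH⟩ := exists_hall n (u2 ^ 2) hcop hv
  have hquot : Nat.card (A ⧸ H) = n := by
    have := AddSubgroup.card_mul_index H
    rw [hH, AddSubgroup.index, Nat.card_eq_fintype_card (α := A), hv, mul_comm] at this
    exact Nat.eq_of_mul_eq_mul_right (by positivity) this
  set h : ℤ := (u2 : ℤ) ^ 2 with hh
  set g := restr f H with hg
  have hcardH : ∑ a : A, (if a ∈ H then (1 : ℤ) else 0) = h := by
    rw [sum_boole, hh]
    have : (univ.filter (fun a => a ∈ H)).card = u2 ^ 2 := by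
      rw [← hH, Nat.card_eq_fintype_card, Fintype.card_subtype]
    exact_mod_cast this
  set sH : ℤ := ∑ a, g a with hsH
  -- trivial on H
  have htriv : ∀ χ : AddChar A ℂ, (∀ a ∈ H, χ a = 1) → charSum g χ = sH := by
    intro χ hχ
    unfold charSum
    rw [hsH]; push_cast
    refine sum_congr rfl fun a _ => ?_
    by_cases ha : a ∈ H
    · rw [hχ a ha, mul_one]
    · simp [hg, restr, ha]
  have hnontriv : ∀ χ : AddChar A ℂ, ¬ (∀ a ∈ H, χ a = 1) → ∃ X : ℤ, charSum g χ = X ∧ h ≤ X ^ 2 := by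
    intro χ hχ
    have e1 := charSum_restr f H n hquot χ
    set E : ℤ := ∑ η : AddChar (A ⧸ H) ℂ, ε (χ * η.compAddMonoidHom (QuotientAddGroup.mk' H)) with hE
    have e2 : (n : ℂ) * charSum g χ = ((u * E : ℤ) : ℂ) := by
      rw [e1, hE]; push_cast; rw [mul_sum]
      refine sum_congr rfl fun η _ => ?_
      apply hε
      intro hz
      apply hχ
      intro a ha
      have := congrArg (fun ψ : AddChar A ℂ => ψ a) hz
      simpa [(QuotientAddGroup.eq_zero_iff a).2 ha] using this
    obtain ⟨X, hX⟩ := int_of_integral (u * E) n (by exact_mod_cast hn0.ne') (charSum g χ)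
      (charSum_integral g χ) (by exact_mod_cast e2)
    have e3 : (n : ℤ) * X = u * E := by rw [hX] at e2; exact_mod_cast e2
    have hEodd : Odd E := by
      apply sign_sum_odd _ _ (fun _ => hε1 _)
      rw [card_univ, AddChar.card_eq, ← Nat.card_eq_fintype_card, hquot]
      exact hnodd
    have hE0 : E ≠ 0 := by rintro hz; rw [hz] at hEodd; revert hEodd; decide
    have hX0 : X ≠ 0 := by
      rintro rfl
      simp at e3
      omega
    have hc : IsCoprime (u2 : ℤ) n := by
      rw [Nat.isCoprime_iff_coprime]
      exact (Nat.Coprime.coprime_dvd_right (dvd_pow_self u2 two_ne_zero) hcop).symm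
    have hd : (u2 : ℤ) ∣ X := hc.dvd_of_dvd_mul_left (by rw [e3]; exact hu2.mul_right E)
    refine ⟨X, hX, ?_⟩
    have := Int.le_of_dvd (by positivity) (pow_dvd_pow_of_dvd hd 2)
    exact this
  -- integer valued versions
  have hex : ∀ χ : AddChar A ℂ, ∃ Y T : ℤ, charSum g χ = Y ∧
      charSum (fun a => if a ∈ H then 1 else 0) χ = T ∧ h ^ 2 - h * T + T * sH ^ 2 ≤ h * Y ^ 2 := by
    intro χ
    by_cases hχ : ∀ a ∈ H, χ a = 1
    · refine ⟨sH, h, htriv χ hχ, ?_, by linarith⟩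
      rw [← hcardH]; unfold charSum; push_cast
      refine sum_congr rfl fun a _ => ?_
      by_cases ha : a ∈ H
      · rw [hχ a ha, mul_one]
      · simp [ha]
    · obtain ⟨X, hX, hX2⟩ := hnontriv χ hχ
      refine ⟨X, 0, hX, ?_, ?_⟩
      · push Not at hχ
        obtain ⟨b, hb, hb1⟩ := hχ
        have : charSum (fun a => if a ∈ H then 1 else 0) χ * χ b
            = charSum (fun a => if a ∈ H then 1 else 0) χ := by
          unfold charSum
          rw [sum_mul]
          rw [← Equiv.sum_comp (Equiv.addRight b) (fun a => (((if a ∈ H then 1 else 0 : ℤ)) : ℂ) * χ a)]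
          refine sum_congr rfl fun a _ => ?_
          simp only [Equiv.coe_addRight, AddChar.map_add_eq_mul, H.add_mem_cancel_right hb]
          ring
        have h2 : charSum (fun a => if a ∈ H then 1 else 0) χ * (χ b - 1) = 0 := by
          rw [mul_sub, this]; ring
        rcases mul_eq_zero.1 h2 with h3 | h3
        · rw [h3]; simp
        · exact absurd (sub_eq_zero.1 h3) hb1
      · have : 0 ≤ h := by positivity
        nlinarith
  choose Y T hY hT hYT using hex
  have hgsymm : ∀ a, g (-a) = g a := by
    intro a; simp [hg, restr, hsymm]
  have hP := charSum_sq_sum g hgsymm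
  have hP2 : ∑ a, g a ^ 2 = h - 1 := by
    have : ∀ a, g a ^ 2 = (if a ∈ H then (1 : ℤ) else 0) - if a = 0 then 1 else 0 := by
      intro a
      by_cases ha : a ∈ H
      · by_cases ha0 : a = 0
        · subst ha0; simp [hg, restr, h0]
        · rcases h1 a ha0 with h | h <;> simp [hg, restr, ha, ha0, h]
      · have ha0 : a ≠ 0 := by rintro rfl; exact ha H.zero_mem
        simp [hg, restr, ha, ha0]
    simp only [this, sum_sub_distrib, hcardH]
    simp
  have hP3 : ∑ χ, Y χ ^ 2 = (Fintype.card A : ℤ) * (h - 1) := by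
    rw [hP2] at hP
    simp only [hY] at hP
    exact_mod_cast hP
  have hT3 : ∑ χ, T χ = (Fintype.card A : ℤ) := by
    have := charSum_inv (fun a => if a ∈ H then 1 else 0) 0
    simp only [hT] at this
    simp at this
    exact_mod_cast this
  have hsum := sum_le_sum fun χ (_ : χ ∈ (univ : Finset (AddChar A ℂ))) => hYT χ
  simp only [sum_add_distrib, sum_sub_distrib, ← mul_sum, ← sum_mul, hP3, hT3] at hsum
  simp only [sum_const, card_univ, AddChar.card_eq] at hsum
  set v : ℤ := (Fintype.card A : ℤ) with hvv
  have hv0 : 0 < v := by rw [hvv]; exact_mod_cast Fintype.card_pos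
  have hs0 : sH = 0 := by
    simp only [nsmul_eq_mul] at hsum
    have : v * sH ^ 2 ≤ 0 := by rw [← hvv] at hsum; nlinarith
    have : sH ^ 2 ≤ 0 := by nlinarith
    nlinarith
  -- conclusion
  have e1 := charSum_restr f H n hquot 0
  rw [← hg, charSum_zero, ← hsH, hs0] at e1
  rw [← add_sum_erase _ _ (mem_univ (0 : AddChar (A ⧸ H) ℂ))] at e1
  set E : ℤ := ∑ η ∈ univ.erase (0 : AddChar (A ⧸ H) ℂ),
    ε (0 * η.compAddMonoidHom (QuotientAddGroup.mk' H)) with hE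
  have e2 : ∑ η ∈ univ.erase (0 : AddChar (A ⧸ H) ℂ),
    charSum f (0 * η.compAddMonoidHom (QuotientAddGroup.mk' H)) = u * E := by
    rw [hE]; push_cast; rw [mul_sum]
    refine sum_congr rfl fun η hη => ?_
    apply hε
    intro hz
    apply ne_of_mem_erase hη
    ext b
    obtain ⟨a, rfl⟩ := QuotientAddGroup.mk_surjective b
    have := congrArg (fun ψ : AddChar A ℂ => ψ a) hz
    simpa using this
  have e3 : charSum f (0 * (0 : AddChar (A ⧸ H) ℂ).compAddMonoidHom (QuotientAddGroup.mk' H))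
      = ((∑ a, f a : ℤ) : ℂ) := by
    rw [← charSum_zero]; congr 1
    ext a; simp
  rw [e2, e3] at e1
  have e4 : ∑ a, f a = - (u * E) := by
    have : (0 : ℂ) = ((∑ a, f a + u * E : ℤ) : ℂ) := by push_cast; simpa using e1
    have : 0 = ∑ a, f a + u * E := by exact_mod_cast this
    linarith
  have hEle : |E| ≤ n - 1 := by
    refine (sign_sum_le _ _ (fun _ => hε1 _)).trans ?_
    rw [card_erase_of_mem (mem_univ _), card_univ, AddChar.card_eq, ← Nat.card_eq_fintype_card, hquot]
    omega
  rw [e4, abs_neg, abs_mul, abs_of_pos hu]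
  exact mul_le_mul_of_nonneg_left hEle hu.le
end

lemma split_coprime (w : ℕ) (u : ℕ) : u ≠ 0 → ∃ u1 u2 : ℕ, u = u1 * u2 ∧ Nat.Coprime u2 w ∧
    ∀ p : ℕ, p.Prime → p ∣ u1 → p ∣ w := by
  induction u using induction_on_primes with
  | zero => intro h; exact absurd rfl h
  | one => exact fun _ => ⟨1, 1, rfl, Nat.coprime_one_left w, fun p hp h =>
      absurd (Nat.dvd_one.1 h) hp.one_lt.ne'⟩
  | prime_mul p a hp ih =>
    intro h
    obtain ⟨u1, u2, h1, h2, h3⟩ := ih (by rintro rfl; simp at h)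
    by_cases hpw : p ∣ w
    · refine ⟨p * u1, u2, by rw [h1, mul_assoc], h2, ?_⟩
      intro q hq hqd
      rcases (hq.dvd_mul).1 hqd with h4 | h4
      · rwa [(Nat.prime_dvd_prime_iff_eq hq hp).1 h4]
      · exact h3 q hq h4
    · exact ⟨u1, p * u2, by rw [h1]; ring,
        Nat.Coprime.mul_left ((Nat.Prime.coprime_iff_not_dvd hp).2 hpw) h2, h3⟩

section
variable {A : Type*} [AddCommGroup A] [Fintype A] [DecidableEq A]

lemma core (f : A → ℤ) (h0 : f 0 = 0) (h1 : ∀ a, a ≠ 0 → f a = 1 ∨ f a = -1)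
    (hsymm : ∀ a, f (-a) = f a) (Δ : ℤ) (hΔ4 : Δ % 4 = 1) (hΔ1 : 1 < Δ) (hΔv : Δ < Fintype.card A)
    (hconv : ∀ a, ∑ b, f b * f (a - b) = (Fintype.card A - 1 - Δ) + if a = 0 then Δ else 0) :
    Fintype.card A = 243 ∧ Δ = 81 := by
  have hsq := charSum_sq f _ _ hconv
  have hss := sum_sq_of_conv f _ _ hconv
  have hs2 : (∑ a, f a) ^ 2 = ((Fintype.card A : ℤ) - 1) * (Fintype.card A - Δ) := by
    rw [hss]; ring
  have hs0 : ∑ a, f a ≠ 0 := by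
    intro h
    rw [h] at hs2
    have : 0 < ((Fintype.card A : ℤ) - 1) * (Fintype.card A - Δ) :=
      mul_pos (by omega) (by omega)
    rw [← hs2] at this
    simp at this
  obtain ⟨u, hu0, hΔu, hus, ε, hε1, hε⟩ := step_a f h0 Δ (by omega) hs0 hsq
  subst hΔu
  have hu1 : 1 < u := by nlinarith
  have huodd : Odd u := by
    rw [← Int.not_even_iff_odd]
    rintro ⟨r, rfl⟩
    ring_nf at hΔ4
    omega
  obtain ⟨a0, ha0⟩ : ∃ a : A, a ≠ 0 := by
    have : 1 < Fintype.card A := by omega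
    have := Fintype.one_lt_card_iff_nontrivial.1 this
    exact exists_ne 0
  have huv := step_b f a0 (h1 a0 ha0) u hu0 hus ε hε
  have hc := step_c f h0 h1 u hu1 huodd hconv
  obtain ⟨t', ht'⟩ := hus
  have hv0 : (0 : ℤ) < Fintype.card A := by omega
  have hdv : u ^ 2 ∣ (Fintype.card A : ℤ) := by
    have hcop : IsCoprime (u ^ 2) ((Fintype.card A : ℤ) - 1) := by
      apply IsCoprime.pow_left
      obtain ⟨q, hq⟩ := huv
      exact ⟨q, -1, by rw [hq]; ring⟩
    apply hcop.dvd_of_dvd_mul_left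
    have : ((Fintype.card A : ℤ) - 1) * Fintype.card A
        = (∑ a, f a) ^ 2 + u ^ 2 * (Fintype.card A - 1) := by rw [hs2]; ring
    rw [this, ht']
    exact ⟨t' ^ 2 + (Fintype.card A - 1), by ring⟩
  obtain ⟨w', hw'⟩ := hdv
  have hw'1 : 1 < w' := by
    rw [hw'] at hΔv
    by_contra hcon
    have : u ^ 2 * w' ≤ u ^ 2 * 1 := mul_le_mul_of_nonneg_left (by omega) (by positivity)
    linarith
  lift w' to ℕ using by omega with w
  lift u to ℕ using by omega with U
  have hvN : Fintype.card A = U ^ 2 * w := by exact_mod_cast hw'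
  have hcN : ∀ p : ℕ, p.Prime → p ∣ Fintype.card A → p ∣ U :=
    fun p hp h => Int.natCast_dvd_natCast.1 (hc p hp h)
  have hUodd : Odd U := by exact_mod_cast huodd
  have hwodd : Odd w := by
    rw [← Nat.not_even_iff_odd, even_iff_two_dvd]
    intro h
    have := hcN 2 Nat.prime_two (hvN ▸ h.mul_left _)
    exact (Nat.not_even_iff_odd.2 hUodd) (even_iff_two_dvd.2 this)
  have hw3 : 3 ≤ w := by
    obtain ⟨r, hr⟩ := hwodd
    omega
  obtain ⟨u1, u2, h12, hcop, hp1⟩ := split_coprime w U (by omega)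
  have ht2 : t' ^ 2 = ((U : ℤ) ^ 2 * w - 1) * (w - 1) := by
    rw [hw', ht'] at hs2
    have : (U : ℤ) ^ 2 * t' ^ 2 = U ^ 2 * (((U : ℤ) ^ 2 * w - 1) * (w - 1)) := by
      linarith
    exact mul_left_cancel₀ (by positivity) this
  have hu1odd : Odd u1 := by
    rw [h12] at hUodd
    exact (Nat.odd_mul.1 hUodd).1
  have hd := step_d f h0 h1 hsymm U hu0 ε hε1 hε (u1 ^ 2 * w) u2 (hu1odd.pow.mul hwodd) (by
      apply Nat.Coprime.pow_right
      apply Nat.Coprime.symm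
      apply Nat.Coprime.mul_right _ hcop
      apply Nat.Coprime.pow_right
      apply Nat.coprime_of_dvd
      intro p hp hp2 hp3
      exact Nat.not_coprime_of_dvd_of_dvd hp.one_lt hp2 (hp1 p hp hp3) hcop)
    (by rw [hvN, h12]; ring) (by rw [h12]; exact ⟨u1, by push_cast; ring⟩)
  rw [ht', abs_mul, abs_of_pos hu0] at hd
  have hd2 := le_of_mul_le_mul_left hd hu0
  obtain ⟨rfl, rfl⟩ := nt_main U w t'.natAbs u1 u2 hw3 hwodd (by omega)
    (by rw [Int.natAbs_sq]; exact ht2) (fun p hp h => hcN p hp (hvN ▸ h.mul_left _)) h12 hp1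
    (by rw [Int.natCast_natAbs]; exact_mod_cast hd2)
  exact ⟨by rw [hvN]; norm_num, by norm_num⟩
end

lemma pds_main (D : Finset G) (v k l m : ℕ)
    (hD : IsRegularPDS D v k l m) (hne : D ≠ ∅) (hne2 : D ≠ univ.erase 1) (hm : m = l + 1) :
    (v = 2 * k + 1 ∧ v = 4 * l + 5 ∧ v = 4 * m + 1) ∨
    (v = 243 ∧ k = 22 ∧ l = 1 ∧ m = 2) ∨
    (v = 243 ∧ k = 220 ∧ l = 199 ∧ m = 200) := by
  obtain ⟨⟨hv, hk, hl, hmm⟩, hinv, h1D⟩ := hD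
  set d : Additive G → ℤ := fun a => if a.toMul ∈ D then 1 else 0 with hd
  have hd0 : d 0 = 0 := by simp [hd, h1D]
  have hdsum : ∑ a, d a = k := by
    rw [← hk]
    have : ∑ a : G, (if a ∈ D then (1 : ℤ) else 0) = D.card := by simp
    rw [← this]
    exact Equiv.sum_comp Additive.toMul (fun a : G => if a ∈ D then (1 : ℤ) else 0)
  have hcv : (Fintype.card (Additive G) : ℤ) = v := by
    rw [← hv]; exact_mod_cast Fintype.card_congr Additive.toMul
  have hdd : ∀ a, ∑ b, d b * d (a - b) = (if a = 0 then (k : ℤ) - m else 0) - d a + m := by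
    intro a
    have e1 : ∑ b, d b * d (a - b) =
        ((univ.filter (fun b : G => b ∈ D ∧ a.toMul * b⁻¹ ∈ D)).card : ℤ) := by
      rw [← sum_boole]
      have : ∑ b : Additive G, d b * d (a - b)
        = ∑ b : Additive G, (if b.toMul ∈ D ∧ a.toMul * b.toMul⁻¹ ∈ D then (1 : ℤ) else 0) := by
        refine sum_congr rfl fun b _ => ?_
        simp only [hd, toMul_sub, div_eq_mul_inv]
        by_cases hx : b.toMul ∈ D <;> by_cases hy : a.toMul * b.toMul⁻¹ ∈ D <;> simp [hx, hy]
      rw [this]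
      exact Equiv.sum_comp Additive.toMul
        (fun b : G => if b ∈ D ∧ a.toMul * b⁻¹ ∈ D then (1 : ℤ) else 0)
    rw [e1]
    by_cases ha : a = 0
    · subst ha
      have : univ.filter (fun b : G => b ∈ D ∧ (0 : Additive G).toMul * b⁻¹ ∈ D) = D := by
        ext b; simp [← hinv b]
      rw [this, hd0, hk]; simp
    · have ha' : a.toMul ≠ 1 := by simpa using ha
      have e2 : (univ.filter (fun b : G => b ∈ D ∧ a.toMul * b⁻¹ ∈ D)).card =
          ((D ×ˢ D).filter (fun x => x.1 ≠ x.2 ∧ x.1 * x.2⁻¹ = a.toMul)).card := by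
        apply card_nbij' (fun b => (b, b * a.toMul⁻¹)) (fun x => x.1)
        · intro b hb
          simp only [coe_filter, mem_univ, true_and, Set.mem_setOf_eq] at hb
          simp only [coe_filter, mem_product, Set.mem_setOf_eq]
          refine ⟨⟨hb.1, ?_⟩, ?_, by simp⟩
          · rw [hinv]; simpa [mul_comm] using hb.2
          · intro h; exact ha' (by simpa using h)
        · rintro ⟨x, y⟩ hx
          simp only [coe_filter, mem_product, Set.mem_setOf_eq] at hx
          simp only [coe_filter, mem_univ, true_and, Set.mem_setOf_eq]
          refine ⟨hx.1.1, ?_⟩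
          rw [← hx.2.2, mul_right_comm, mul_inv_cancel, one_mul, ← hinv]
          exact hx.1.2
        · intro b _; rfl
        · rintro ⟨x, y⟩ hx
          simp only [coe_filter, mem_product, Set.mem_setOf_eq] at hx
          simp only [← hx.2.2]
          simp
      rw [e2]
      by_cases haD : a.toMul ∈ D
      · rw [hl _ ha' haD]; simp [hd, haD, ha, hm]
      · rw [hmm _ ha' haD]; simp [hd, haD, ha]
  set Δ : ℤ := 1 + 4 * ((k : ℤ) - m) with hΔ
  set f : Additive G → ℤ := fun a => 2 * d a + (if a = 0 then 1 else 0) - 1 with hf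
  have hf0 : f 0 = 0 := by simp [hf, hd0]
  have hf1 : ∀ a, a ≠ 0 → f a = 1 ∨ f a = -1 := by
    intro a ha
    by_cases haD : a.toMul ∈ D
    · left; simp [hf, hd, ha, haD]
    · right; simp [hf, hd, ha, haD]
  have hfs : ∀ a, f (-a) = f a := by
    intro a
    simp only [hf, hd, toMul_neg, ← hinv, neg_eq_zero]
  have hconv : ∀ a, ∑ b, f b * f (a - b) =
      (Fintype.card (Additive G) - 1 - Δ) + if a = 0 then Δ else 0 := by
    intro a
    have e2 : ∑ b, d (a - b) = k := (Equiv.sum_comp (Equiv.subLeft a) d).trans hdsum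
    have e3 : ∀ b : Additive G, (a - b = 0) = (b = a) := fun b => by
      rw [sub_eq_zero]; exact propext eq_comm
    have e4 : ∀ b : Additive G, f b * f (a - b) = 4 * (d b * d (a - b))
        + 2 * (if b = a then d b else 0) - 2 * d b + 2 * (if b = 0 then d (a - b) else 0)
        + (if b = a then (if b = 0 then 1 else 0) else 0) - (if b = 0 then 1 else 0)
        - 2 * d (a - b) - (if b = a then 1 else 0) + 1 := by
      intro b
      simp only [hf, e3]
      split_ifs <;> ring
    simp only [e4, sum_add_distrib, sum_sub_distrib, ← mul_sum, hdd, hdsum, e2]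
    simp [hcv]
    split_ifs <;> rw [hΔ] <;> ring
  have hkk : (k : ℤ) ^ 2 = m * (v - 1) := by
    have e : (∑ a, d a) ^ 2 = ∑ a, ∑ b, d b * d (a - b) := by
      rw [sq, sum_mul_sum, sum_comm (s := univ) (t := univ) (f := fun a b => d b * d (a - b))]
      refine sum_congr rfl fun b _ => ?_
      rw [← Equiv.sum_comp (Equiv.addRight b) (fun x => d b * d (x - b))]
      simp
    simp only [hdd, sum_add_distrib, sum_sub_distrib, hdsum] at e
    simp at e
    rw [e, hv]
    ring
  have hk1 : 1 ≤ k := by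
    rw [← hk]; exact card_pos.2 (nonempty_iff_ne_empty.2 hne)
  have hcE : (univ.erase (1 : G)).card = v - 1 := by
    rw [card_erase_of_mem (mem_univ _), card_univ, hv]
  have hsub : D ⊆ univ.erase 1 := by
    intro x hx
    simp only [mem_erase, mem_univ, and_true]
    rintro rfl; exact h1D hx
  have hklt : k < v - 1 := by
    rw [← hk, ← hcE]
    exact card_lt_card (hsub.ssubset_of_ne hne2)
  have hv2 : (k : ℤ) < v - 1 := by omega
  have hmk : (m : ℤ) < k := by
    by_contra hcon
    have : (k : ℤ) * k < m * (v - 1) := by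
      have : (k : ℤ) * k < k * (v - 1) := mul_lt_mul_of_pos_left hv2 (by omega)
      have : (k : ℤ) * (v - 1) ≤ m * (v - 1) := mul_le_mul_of_nonneg_right (by omega) (by omega)
      linarith
    nlinarith
  have hss := sum_sq_of_conv f _ _ hconv
  have hfsum : ∑ a, f a = 2 * k + 1 - v := by
    simp only [hf, sum_add_distrib, sum_sub_distrib, ← mul_sum, hdsum]
    simp [hv]
  rw [hfsum, hcv] at hss
  have hss2 : (2 * (k : ℤ) + 1 - v) ^ 2 = (v - 1) * (v - Δ) := by rw [hss]; ring
  have hle : Δ ≤ v := by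
    by_contra hcon
    have : ((v : ℤ) - 1) * (v - Δ) < 0 := mul_neg_of_pos_of_neg (by omega) (by omega)
    have := sq_nonneg (2 * (k : ℤ) + 1 - v)
    linarith
  rcases hle.eq_or_lt with h | h
  · left
    rw [h, sub_self, mul_zero] at hss2
    have := pow_eq_zero_iff (two_ne_zero) |>.1 hss2
    omega
  · right
    obtain ⟨c1, c2⟩ := core f hf0 hf1 hfs Δ (by omega) (by omega) (by rw [hcv]; exact h) hconv
    have hv243 : v = 243 := by rw [c1] at hcv; exact_mod_cast hcv.symm
    subst hv243
    have hm20 : (m : ℤ) = k - 20 := by omega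
    rw [hm20] at hkk
    have : ((k : ℤ) - 22) * (k - 220) = 0 := by push_cast at hkk; linarith
    rcases mul_eq_zero.1 this with h' | h'
    · left; omega
    · right; omega

/-- (Arasu–Jungnickel–Ma–Pott) A nontrivial regular `(v,k,λ,μ)`-PDS in an abelian group with
`λ - μ = -1` has, up to complementation, Paley type parameters or parameters `(243,22,1,2)`. -/
theorem stmt5 (D : Finset G) (v k l m : ℕ)
    (hD : IsRegularPDS D v k l m) (hnt : ¬ IsTrivialPDS D)
    (hβ : (l : ℤ) - m = -1) :
    (v = 2 * k + 1 ∧ v = 4 * l + 5 ∧ v = 4 * m + 1) ∨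
    (v = 243 ∧ k = 22 ∧ l = 1 ∧ m = 2) ∨
    (v = 243 ∧ k = 220 ∧ l = 199 ∧ m = 200) := by
  apply pds_main D v k l m hD
  · rintro rfl
    exact hnt (Or.inl ⟨⊥, by simp⟩)
  · rintro rfl
    refine hnt (Or.inr ⟨⊥, ?_⟩)
    ext x; simp
  · omega
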